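/- Let ρ : (a,b) → P_o(G) be a differentiable solution of the Fokker–Planck equation ρ'(t) = −L(ρ(t))F(ρ(t)). Then for all t ∈ (a,b), (d/dt) 𝓕(ρ(t)) = −F(ρ(t))^T L(ρ(t)) F(ρ(t)) = −(1/2)Σ_{(i,j)∈E} ω_{ij}·(F_i(ρ(t)) − F_j(ρ(t)))²·θ_{ij}(ρ(t)) ≤ 0. -/

import Mathlib

open Finset Filter Matrix
open scoped Classical

noncomputable section

namespace FPEGraph

variable {n : ℕ}

/-- Edge average `θ_{ij}(ρ) = (ρ_i + ρ_j)/2`. -/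
def theta (ρ : Fin n → ℝ) (i j : Fin n) : ℝ := (ρ i + ρ j) / 2

/-- Weighted graph Laplacian `L(ρ)`, satisfying
`(L(ρ)Φ)_i = ∑_{j} ω_{ij} θ_{ij}(ρ) (Φ_i - Φ_j)` (the sum over all `j` equals the
sum over neighbors since `ω_{ij} = 0` off edges). -/
def Lmat (ω : Fin n → Fin n → ℝ) (ρ : Fin n → ℝ) : Matrix (Fin n) (Fin n) ℝ :=
  fun i j => if i = j then ∑ k, ω i k * theta ρ i k else -(ω i j * theta ρ i j)

/-- Graph Laplacian `L̂`, with `(L̂Φ)_i = ∑_{j} ω_{ij} (Φ_i - Φ_j)`. -/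
def Lhat (ω : Fin n → Fin n → ℝ) : Matrix (Fin n) (Fin n) ℝ :=
  fun i j => if i = j then ∑ k, ω i k else -(ω i j)

/-- Connectivity of the weighted graph: any two vertices are joined by a chain of edges. -/
def Conn (ω : Fin n → Fin n → ℝ) : Prop :=
  ∀ i j : Fin n, Relation.ReflTransGen (fun a b => ω a b ≠ 0) i j

/-- `ω` encodes a connected undirected weighted graph without self-loops:
symmetric nonnegative weights, zero diagonal, connected (edges are pairs with `ω_{ij} > 0`,
i.e. `ω_{ij} ≠ 0`). -/
def IsGraph (ω : Fin n → Fin n → ℝ) : Prop :=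
  (∀ i j, ω i j = ω j i) ∧ (∀ i, ω i i = 0) ∧ (∀ i j, 0 ≤ ω i j) ∧ Conn ω

/-- The probability simplex `P(G)`. -/
def PG (ρ : Fin n → ℝ) : Prop := (∑ i, ρ i) = 1 ∧ ∀ i, 0 ≤ ρ i

/-- The interior `P_o(G)` of the probability simplex. -/
def PoG (ρ : Fin n → ℝ) : Prop := (∑ i, ρ i) = 1 ∧ ∀ i, 0 < ρ i

/-- Free energy `𝓕(ρ) = (1/2) ρᵀ𝕎ρ + 𝕍ᵀρ + β ∑ᵢ ρᵢ log ρᵢ`. -/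
def freeEnergy (W : Matrix (Fin n) (Fin n) ℝ) (V : Fin n → ℝ) (β : ℝ) (ρ : Fin n → ℝ) : ℝ :=
  (1/2) * (ρ ⬝ᵥ W.mulVec ρ) + V ⬝ᵥ ρ + β * ∑ i, ρ i * Real.log (ρ i)

/-- Gradient `F(ρ)` of the free energy, `F_i(ρ) = 𝕍_i + (𝕎ρ)_i + β log ρ_i + β`. -/
def gradF (W : Matrix (Fin n) (Fin n) ℝ) (V : Fin n → ℝ) (β : ℝ) (ρ : Fin n → ℝ) :
    Fin n → ℝ :=
  fun i => V i + W.mulVec ρ i + β * Real.log (ρ i) + β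

/-- Hessian `Hess𝓕(ρ) = 𝕎 + β diag(1/ρ₁, …, 1/ρₙ)`. -/
def hessF (W : Matrix (Fin n) (Fin n) ℝ) (β : ℝ) (ρ : Fin n → ℝ) :
    Matrix (Fin n) (Fin n) ℝ :=
  W + β • Matrix.diagonal (fun i => (ρ i)⁻¹)

/-- Gibbs measure: `ρ∞ ∈ P_o(G)` with `ρ∞_i = e^{-((𝕎ρ∞)_i + 𝕍_i)/β} / K`. -/
def IsGibbs (W : Matrix (Fin n) (Fin n) ℝ) (V : Fin n → ℝ) (β : ℝ) (ρ : Fin n → ℝ) : Prop :=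
  PoG ρ ∧ ∀ i, ρ i = Real.exp (-(W.mulVec ρ i + V i) / β) /
      ∑ j, Real.exp (-(W.mulVec ρ j + V j) / β)

/-- A continuously differentiable solution `ρ : [0,∞) → P_o(G)` of the Fokker–Planck
equation `ρ' = -L(ρ)F(ρ)`. -/
def IsSolution (ω : Fin n → Fin n → ℝ) (W : Matrix (Fin n) (Fin n) ℝ) (V : Fin n → ℝ)
    (β : ℝ) (ρ : ℝ → Fin n → ℝ) : Prop :=
  (∀ t ∈ Set.Ici (0:ℝ), PoG (ρ t)) ∧
  ∀ t ∈ Set.Ici (0:ℝ),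
    HasDerivWithinAt ρ (-(Lmat ω (ρ t)).mulVec (gradF W V β (ρ t))) (Set.Ici 0) t

/-- `M = e^{2 max_{i,j}(|𝕍_i| + |𝕎_{ij}|)}`. -/
def Mconst (W : Matrix (Fin n) (Fin n) ℝ) (V : Fin n → ℝ) : ℝ :=
  Real.exp (2 * ⨆ i : Fin n, ⨆ j : Fin n, (|V i| + |W i j|))

/-- `m(ρ⁰) = (1/2) (1/(1+(2M)^{1/β}))^{n-2} min{1/(1+(2M)^{1/β}), minᵢ ρ⁰ᵢ}`. -/
def mconst (W : Matrix (Fin n) (Fin n) ℝ) (V : Fin n → ℝ) (β : ℝ) (ρ0 : Fin n → ℝ) : ℝ :=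
  (1/2) * (1 / (1 + (2 * Mconst W V) ^ (1/β)))^(n-2) *
    min (1 / (1 + (2 * Mconst W V) ^ (1/β))) (⨅ i, ρ0 i)

/-- Second smallest eigenvalue (via the Rayleigh quotient on the orthogonal complement of
the constants; for the symmetric PSD Laplacians considered here, whose kernel is spanned by
the constant vector, this is exactly the second-smallest eigenvalue with multiplicity). -/
def lamSec (A : Matrix (Fin n) (Fin n) ℝ) : ℝ :=
  sInf {x | ∃ Φ : Fin n → ℝ, (∑ i, Φ i) = 0 ∧ (∑ i, (Φ i)^2) = 1 ∧ x = Φ ⬝ᵥ A.mulVec Φ}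

/-- Largest eigenvalue of a symmetric matrix, via the Rayleigh quotient. -/
def lamMax (A : Matrix (Fin n) (Fin n) ℝ) : ℝ :=
  sSup {x | ∃ Φ : Fin n → ℝ, (∑ i, (Φ i)^2) = 1 ∧ x = Φ ⬝ᵥ A.mulVec Φ}

/-- Maximum absolute column sum norm `‖A‖₁`. -/
def matNorm1 (A : Matrix (Fin n) (Fin n) ℝ) : ℝ := ⨆ j : Fin n, ∑ i, |A i j|

/-- Maximal vertex degree `Deg(G)`. -/
def maxDeg (ω : Fin n → Fin n → ℝ) : ℕ :=
  Finset.univ.sup fun i => (Finset.univ.filter fun j => ω i j ≠ 0).card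

/-- Maximal edge weight `max_{(i,j)∈E} ω_{ij}` (equal to the max over all pairs since
`ω = 0` off edges and weights are positive on edges). -/
def maxWeight (ω : Fin n → Fin n → ℝ) : ℝ := ⨆ i : Fin n, ⨆ j : Fin n, ω i j

/-- A vector field on `G`: a skew-symmetric matrix vanishing off edges. -/
def IsVF (ω : Fin n → Fin n → ℝ) (v : Fin n → Fin n → ℝ) : Prop :=
  (∀ i j, v i j = - v j i) ∧ ∀ i j, ω i j = 0 → v i j = 0

/-- Potential vector field `(∇_G Φ)_{ij} = √ω_{ij} (Φ_i - Φ_j)` (this vanishes off edges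
since `ω_{ij} = 0` there). -/
def gradG (ω : Fin n → Fin n → ℝ) (Φ : Fin n → ℝ) : Fin n → Fin n → ℝ :=
  fun i j => Real.sqrt (ω i j) * (Φ i - Φ j)

/-- Divergence `div_G(ρv)_i = -∑_j √ω_{ij} v_{ij} θ_{ij}(ρ)` (sum over all `j` equals the
sum over neighbors since `√ω_{ij} = 0` off edges). -/
def divG (ω : Fin n → Fin n → ℝ) (ρ : Fin n → ℝ) (v : Fin n → Fin n → ℝ) : Fin n → ℝ :=
  fun i => -∑ j, Real.sqrt (ω i j) * v i j * theta ρ i j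

/-- Inner product `(v,w)_ρ = (1/2) ∑_{(i,j)∈E} v_{ij} w_{ij} θ_{ij}(ρ)`. -/
def innerG (ω : Fin n → Fin n → ℝ) (ρ : Fin n → ℝ) (v w : Fin n → Fin n → ℝ) : ℝ :=
  (1/2) * ∑ i, ∑ j, if ω i j ≠ 0 then v i j * w i j * theta ρ i j else 0


theorem Lmat_mulVec_apply {ω : Fin n → Fin n → ℝ} (hω : ∀ i, ω i i = 0) (ρ Φ : Fin n → ℝ)
    (i : Fin n) :
    (Lmat ω ρ).mulVec Φ i = ∑ j, ω i j * theta ρ i j * (Φ i - Φ j) := by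
  have hentry : ∀ j, Lmat ω ρ i j * Φ j =
      (if i = j then (∑ k, ω i k * theta ρ i k) * Φ j else 0) - ω i j * theta ρ i j * Φ j := by
    intro j
    by_cases h : i = j
    · subst h
      simp [Lmat, hω]
    · simp [Lmat, h]
  simp only [mulVec, dotProduct, hentry, Finset.sum_sub_distrib, mul_sub, Finset.sum_ite_eq,
    Finset.mem_univ, if_true, Finset.sum_mul]

/-- The Dirichlet form of the weighted graph Laplacian. -/
theorem dotProduct_Lmat_mulVec {ω : Fin n → Fin n → ℝ} (hsymm : ∀ i j, ω i j = ω j i)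
    (hω : ∀ i, ω i i = 0) (ρ Φ : Fin n → ℝ) :
    Φ ⬝ᵥ (Lmat ω ρ).mulVec Φ =
      (1/2) * ∑ i, ∑ j, ω i j * (Φ i - Φ j)^2 * theta ρ i j := by
  have hdot : Φ ⬝ᵥ (Lmat ω ρ).mulVec Φ =
      ∑ i, ∑ j, Φ i * (ω i j * theta ρ i j * (Φ i - Φ j)) := by
    simp only [dotProduct, Lmat_mulVec_apply hω, Finset.mul_sum]
  have hswap : Φ ⬝ᵥ (Lmat ω ρ).mulVec Φ =
      ∑ i, ∑ j, Φ j * (ω i j * theta ρ i j * (Φ j - Φ i)) := by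
    rw [hdot, Finset.sum_comm]
    refine Finset.sum_congr rfl fun i _ => Finset.sum_congr rfl fun j _ => ?_
    rw [hsymm j i, theta, theta, add_comm (ρ j)]
  have hadd : Φ ⬝ᵥ (Lmat ω ρ).mulVec Φ + Φ ⬝ᵥ (Lmat ω ρ).mulVec Φ =
      ∑ i, ∑ j, ω i j * (Φ i - Φ j)^2 * theta ρ i j := by
    nth_rewrite 1 [hdot]
    rw [hswap, ← Finset.sum_add_distrib]
    refine Finset.sum_congr rfl fun i _ => ?_
    rw [← Finset.sum_add_distrib]
    exact Finset.sum_congr rfl fun j _ => by ring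
  linarith

/-- Chain rule for the free energy along a differentiable curve with nonzero coordinates. -/
theorem hasDerivAt_freeEnergy {W : Matrix (Fin n) (Fin n) ℝ} (hW : W.IsSymm) (V : Fin n → ℝ)
    (β : ℝ) {ρ : ℝ → Fin n → ℝ} {v : Fin n → ℝ} {t : ℝ} (hρ : ∀ i, ρ t i ≠ 0)
    (hv : HasDerivAt ρ v t) :
    HasDerivAt (fun s => freeEnergy W V β (ρ s)) (gradF W V β (ρ t) ⬝ᵥ v) t := by
  have hcoord : ∀ i, HasDerivAt (fun s => ρ s i) (v i) t := hasDerivAt_pi.1 hv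
  have hmul : ∀ i, HasDerivAt (fun s => W.mulVec (ρ s) i) (W.mulVec v i) t := by
    intro i
    simp only [mulVec, dotProduct]
    exact HasDerivAt.fun_sum fun j _ => (hcoord j).const_mul (W i j)
  have hquad : HasDerivAt (fun s => ρ s ⬝ᵥ W.mulVec (ρ s))
      (∑ i, (v i * W.mulVec (ρ t) i + ρ t i * W.mulVec v i)) t :=
    HasDerivAt.fun_sum fun i _ => (hcoord i).mul (hmul i)
  have hlin : HasDerivAt (fun s => V ⬝ᵥ ρ s) (∑ i, V i * v i) t :=
    HasDerivAt.fun_sum fun i _ => (hcoord i).const_mul (V i)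
  have hent : HasDerivAt (fun s => ∑ i, ρ s i * Real.log (ρ s i))
      (∑ i, (Real.log (ρ t i) + 1) * v i) t :=
    HasDerivAt.fun_sum fun i _ =>
      HasDerivAt.comp (h₂ := fun x => x * Real.log x) t (Real.hasDerivAt_mul_log (hρ i)) (hcoord i)
  have hsymm : ∑ i, ρ t i * W.mulVec v i = ∑ i, v i * W.mulVec (ρ t) i := by
    change ρ t ⬝ᵥ W.mulVec v = v ⬝ᵥ W.mulVec (ρ t)
    rw [dotProduct_mulVec, ← mulVec_transpose, hW.eq, dotProduct_comm]
  refine (((hquad.const_mul (1/2)).add hlin).add (hent.const_mul β)).congr_deriv ?_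
  rw [Finset.sum_add_distrib, hsymm, ← two_mul, ← mul_assoc, one_div,
    inv_mul_cancel₀ two_ne_zero, one_mul, Finset.mul_sum, ← Finset.sum_add_distrib,
    ← Finset.sum_add_distrib]
  refine Finset.sum_congr rfl fun i _ => ?_
  rw [gradF]
  ring

/-- entropy dissipation identity
`d𝓕(ρ(t))/dt = -F(ρ(t))ᵀ L(ρ(t)) F(ρ(t)) = -(1/2)∑_{(i,j)∈E} ω_{ij}(F_i - F_j)² θ_{ij} ≤ 0`
along solutions of the Fokker–Planck equation. -/
theorem freeEnergy_dissipation
    (n : ℕ) (hn : 2 ≤ n) (ω : Fin n → Fin n → ℝ) (hG : IsGraph ω)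
    (W : Matrix (Fin n) (Fin n) ℝ) (hW : W.IsSymm) (V : Fin n → ℝ) (β : ℝ) (hβ : 0 < β)
    (a b : ℝ) (ρ : ℝ → Fin n → ℝ)
    (hρ : ∀ t ∈ Set.Ioo a b, PoG (ρ t))
    (hode : ∀ t ∈ Set.Ioo a b,
      HasDerivAt ρ (-(Lmat ω (ρ t)).mulVec (gradF W V β (ρ t))) t) :
    ∀ t ∈ Set.Ioo a b,
      HasDerivAt (fun s => freeEnergy W V β (ρ s))
        (-(gradF W V β (ρ t) ⬝ᵥ (Lmat ω (ρ t)).mulVec (gradF W V β (ρ t)))) t ∧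
      (gradF W V β (ρ t) ⬝ᵥ (Lmat ω (ρ t)).mulVec (gradF W V β (ρ t))) =
        (1/2) * ∑ i, ∑ j,
          ω i j * (gradF W V β (ρ t) i - gradF W V β (ρ t) j)^2 * theta (ρ t) i j ∧
      (-(gradF W V β (ρ t) ⬝ᵥ (Lmat ω (ρ t)).mulVec (gradF W V β (ρ t)))) ≤ 0 := by
  intro t ht
  obtain ⟨hsymm, hdiag, hnonneg, -⟩ := hG
  have hpos := (hρ t ht).2
  have hform := dotProduct_Lmat_mulVec hsymm hdiag (ρ t) (gradF W V β (ρ t))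
  refine ⟨?_, hform, ?_⟩
  · rw [← dotProduct_neg]
    exact hasDerivAt_freeEnergy hW V β (fun i => (hpos i).ne') (hode t ht)
  · rw [hform, neg_nonpos]
    refine mul_nonneg (by norm_num) (Finset.sum_nonneg fun i _ => Finset.sum_nonneg fun j _ => ?_)
    have hθ : 0 ≤ theta (ρ t) i j := div_nonneg (add_pos (hpos i) (hpos j)).le zero_le_two
    exact mul_nonneg (mul_nonneg (hnonneg i j) (sq_nonneg _)) hθ

end FPEGraph
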